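/- arXiv:1801.07793 — 2 statements merged into one kernel-verified Lean document; each statement's English description precedes it below -/
import Mathlib

section
/- For any two non-strict incomplete rankings a, b of n ≥ 2 objects, the projected Kemeny–Snell distance and the Kendall tau-extended correlation coefficient are related by d_{P-KS}(a,b) = n̄(a,b)·(n̄(a,b)−1)/4 − (n(n−1)/4)·τ_x(a,b). -/
open Finset

/-- A non-strict incomplete ranking of `n` objects: object `i` is ranked iff `a i ≠ none`. -/
abbrev Ranking (n : ℕ) := Fin n → Option ℕ

/-- The set of objects ranked by `a`. -/
def ranked {n : ℕ} (a : Ranking n) : Finset (Fin n) :=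
  Finset.univ.filter fun i => (a i).isSome

/-- The ranking-matrix of `a`. -/
def rmat {n : ℕ} (a : Ranking n) (i j : Fin n) : ℤ :=
  if i = j then 0
  else
    match a i, a j with
    | some x, some y => if x ≤ y then 1 else -1
    | _, _ => 0

/-- `n̄(a,b)`: the number of objects ranked by both `a` and `b`. -/
def nbar {n : ℕ} (a b : Ranking n) : ℕ := (ranked a ∩ ranked b).card

/-- The scaled Kendall tau-extended correlation coefficient `τ̂ₓ(a,b)`. -/
def tauHat {n : ℕ} (a b : Ranking n) : ℚ :=
  (∑ i : Fin n, ∑ j : Fin n, ((rmat a i j * rmat b i j : ℤ) : ℚ)) /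
    ((nbar a b : ℚ) * ((nbar a b : ℚ) - 1))

/-- The Kendall tau-extended correlation coefficient `τₓ(a,b)` (extended ranking-matrix). -/
def tauX {n : ℕ} (a b : Ranking n) : ℚ :=
  (∑ i : Fin n, ∑ j : Fin n, ((rmat a i j * rmat b i j : ℤ) : ℚ)) /
    ((n : ℚ) * ((n : ℚ) - 1))

/-- The projected Kemeny–Snell distance (minimum distance unit 1/2). -/
def dPKS {n : ℕ} (a b : Ranking n) : ℚ :=
  (1/4) * ∑ i ∈ ranked a ∩ ranked b, ∑ j ∈ ranked a ∩ ranked b,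
    ((|(((a i).getD 0 : ℤ) - ((a j).getD 0 : ℤ)).sign -
       (((b i).getD 0 : ℤ) - ((b j).getD 0 : ℤ)).sign| : ℤ) : ℚ)

/-- The normalized projected Kemeny–Snell distance. -/
def dNPKS {n : ℕ} (a b : Ranking n) : ℚ :=
  if 2 ≤ nbar a b then
    dPKS a b / ((nbar a b : ℚ) * ((nbar a b : ℚ) - 1) / 2)
  else 0

/-- The projection of `a` onto the subset `S` of objects. -/
def proj {n : ℕ} (a : Ranking n) (S : Finset (Fin n)) : Ranking n :=
  fun i => if i ∈ S then a i else none

theorem rmat_eq_zero_of_not_mem_left {n : ℕ} {a : Ranking n} {i : Fin n} (hi : i ∉ ranked a)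
    (j : Fin n) : rmat a i j = 0 := by
  have h : a i = none := by simpa [ranked] using hi
  simp [rmat, h]

theorem rmat_eq_zero_of_not_mem_right {n : ℕ} {a : Ranking n} {j : Fin n} (hj : j ∉ ranked a)
    (i : Fin n) : rmat a i j = 0 := by
  have h : a j = none := by simpa [ranked] using hj
  simp [rmat, h]

theorem rmat_eq_ite {n : ℕ} {a : Ranking n} {i j : Fin n} (hi : i ∈ ranked a)
    (hj : j ∈ ranked a) (hij : i ≠ j) :
    rmat a i j = if (a i).getD 0 ≤ (a j).getD 0 then 1 else -1 := by
  obtain ⟨x, hx⟩ : ∃ x, a i = some x := by simpa [ranked, Option.isSome_iff_exists] using hi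
  obtain ⟨y, hy⟩ : ∃ y, a j = some y := by simpa [ranked, Option.isSome_iff_exists] using hj
  simp [rmat, hij, hx, hy]

/-- Only the commonly ranked objects contribute to the matrix inner product. -/
theorem sum_rmat_mul_rmat {n : ℕ} (a b : Ranking n) :
    ∑ i, ∑ j, rmat a i j * rmat b i j =
      ∑ i ∈ ranked a ∩ ranked b, ∑ j ∈ ranked a ∩ ranked b, rmat a i j * rmat b i j := by
  have hzero : ∀ i j, i ∉ ranked a ∩ ranked b ∨ j ∉ ranked a ∩ ranked b →
      rmat a i j * rmat b i j = 0 := by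
    intro i j h
    simp only [Finset.mem_inter, not_and_or] at h
    rcases h with (h | h) | (h | h) <;>
      simp [rmat_eq_zero_of_not_mem_left, rmat_eq_zero_of_not_mem_right, h]
  symm
  rw [Finset.sum_subset (Finset.subset_univ (ranked a ∩ ranked b)) fun i _ hi =>
    Finset.sum_eq_zero fun j _ => hzero i j (Or.inl hi)]
  exact Finset.sum_congr rfl fun i _ =>
    Finset.sum_subset (Finset.subset_univ _) fun j _ hj => hzero i j (Or.inr hj)

theorem Finset.sum_sum_eq_zero_of_antisymm {ι : Type*} (s : Finset ι) (f : ι → ι → ℤ)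
    (h : ∀ i ∈ s, ∀ j ∈ s, f i j + f j i = 0) : ∑ i ∈ s, ∑ j ∈ s, f i j = 0 := by
  have hsum : ∑ i ∈ s, ∑ j ∈ s, (f i j + f j i) = 0 :=
    Finset.sum_eq_zero fun i hi => Finset.sum_eq_zero fun j hj => h i hi j hj
  simp only [Finset.sum_add_distrib] at hsum
  rw [Finset.sum_comm (f := fun i j => f j i)] at hsum
  omega

theorem Finset.sum_sum_ite_eq_zero_one {ι : Type*} [DecidableEq ι] (s : Finset ι) :
    ∑ i ∈ s, ∑ j ∈ s, (if i = j then (0 : ℤ) else 1) = s.card * (s.card - 1) := by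
  have h : ∀ i j : ι, (if i = j then (0 : ℤ) else 1) = 1 - if i = j then 1 else 0 := by
    intro i j
    split_ifs <;> rfl
  simp only [h, Finset.sum_sub_distrib, Finset.sum_ite_eq, Finset.sum_ite_mem, Finset.inter_self,
    Finset.sum_const, nsmul_eq_mul, mul_one]
  ring

/-- The contribution of one unordered pair to the distance, with `x`, `y` its ranks in the first
ranking and `z`, `w` its ranks in the second. -/
theorem abs_sign_sub_sign_symm_add (x y z w : ℕ) :
    |((x : ℤ) - y).sign - ((z : ℤ) - w).sign| + |((y : ℤ) - x).sign - ((w : ℤ) - z).sign| +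
      ((if x ≤ y then 1 else -1) * (if z ≤ w then 1 else -1) +
        (if y ≤ x then 1 else -1) * (if w ≤ z then 1 else -1)) = 2 := by
  have hsign : ∀ u v : ℕ, ((u : ℤ) - v).sign = if u < v then -1 else if u = v then 0 else 1 := by
    intro u v
    rcases lt_trichotomy u v with h | h | h
    · rw [Int.sign_eq_neg_one_of_neg (by omega), if_pos h]
    · simp [h]
    · rw [Int.sign_eq_one_of_pos (by omega), if_neg (by omega), if_neg (by omega)]
  simp only [hsign]
  rcases lt_trichotomy x y with h | h | h <;> rcases lt_trichotomy z w with h' | h' | h' <;>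
    grind

theorem sum_abs_sign_sub_sign_add_sum_rmat {n : ℕ} (a b : Ranking n) :
    ∑ i ∈ ranked a ∩ ranked b, ∑ j ∈ ranked a ∩ ranked b,
        |(((a i).getD 0 : ℤ) - ((a j).getD 0 : ℤ)).sign -
          (((b i).getD 0 : ℤ) - ((b j).getD 0 : ℤ)).sign| +
      ∑ i, ∑ j, rmat a i j * rmat b i j = (nbar a b : ℤ) * (nbar a b - 1) := by
  rw [sum_rmat_mul_rmat, nbar, ← Finset.sum_sum_ite_eq_zero_one, ← sub_eq_zero]
  simp only [← Finset.sum_add_distrib, ← Finset.sum_sub_distrib]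
  refine Finset.sum_sum_eq_zero_of_antisymm _ _ fun i hi j hj => ?_
  rw [Finset.mem_inter] at hi hj
  by_cases hij : i = j
  · simp [hij, rmat]
  · have h := abs_sign_sub_sign_symm_add ((a i).getD 0) ((a j).getD 0) ((b i).getD 0)
      ((b j).getD 0)
    rw [rmat_eq_ite hi.1 hj.1 hij, rmat_eq_ite hi.2 hj.2 hij, rmat_eq_ite hj.1 hi.1 (Ne.symm hij),
      rmat_eq_ite hj.2 hi.2 (Ne.symm hij), if_neg hij, if_neg (Ne.symm hij)]
    linarith

/-- Theorem 2: linear transformation between τₓ and d_P-KS. -/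
theorem dPKS_eq_of_tauX (n : ℕ) (hn : 2 ≤ n) (a b : Ranking n) :
    dPKS a b =
      (nbar a b : ℚ) * ((nbar a b : ℚ) - 1) / 4 -
        ((n : ℚ) * ((n : ℚ) - 1) / 4) * tauX a b := by
  have hn' : (n : ℚ) * ((n : ℚ) - 1) ≠ 0 := by
    have h : (2 : ℚ) ≤ n := by exact_mod_cast hn
    exact mul_ne_zero (by linarith) (by linarith)
  have h := congrArg (Int.cast : ℤ → ℚ) (sum_abs_sign_sub_sign_add_sum_rmat a b)
  rw [dPKS, tauX, div_mul_div_comm, mul_comm (4 : ℚ), mul_div_mul_left _ _ hn']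
  simp only [Int.cast_add, Int.cast_sum, Int.cast_sub, Int.cast_mul, Int.cast_natCast,
    Int.cast_one] at h ⊢
  linarith
end

section
/- (Relevance axiom for τ̂_x.) For any two non-strict incomplete rankings a, b of n objects with n̄(a,b) ≥ 2, the correlation discounts unevaluated objects: τ̂_x(a, b) = τ̂_x(a|_{V_a ∩ V_b}, b|_{V_a ∩ V_b}), where a|_S denotes the projection of a onto S. -/
open Finset

lemma mem_ranked {n : ℕ} {a : Ranking n} {i : Fin n} : i ∈ ranked a ↔ (a i).isSome := by
  simp [ranked]

lemma rmat_proj {n : ℕ} (a : Ranking n) (S : Finset (Fin n)) (i j : Fin n) :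
    rmat (proj a S) i j = if i ∈ S ∧ j ∈ S then rmat a i j else 0 := by
  by_cases hi : i ∈ S <;> by_cases hj : j ∈ S <;> simp [rmat, proj, hi, hj]

lemma rmat_eq_zero {n : ℕ} {a : Ranking n} {i j : Fin n}
    (h : ¬(i ∈ ranked a ∧ j ∈ ranked a)) : rmat a i j = 0 := by
  cases hi : a i <;> cases hj : a j <;> simp_all [rmat, mem_ranked]

lemma ranked_proj {n : ℕ} (a : Ranking n) (S : Finset (Fin n)) :
    ranked (proj a S) = ranked a ∩ S := by
  ext i
  by_cases hi : i ∈ S <;> simp [mem_ranked, proj, hi]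

lemma nbar_proj {n : ℕ} (a b : Ranking n) :
    nbar (proj a (ranked a ∩ ranked b)) (proj b (ranked a ∩ ranked b)) = nbar a b := by
  unfold nbar
  rw [ranked_proj, ranked_proj]
  congr 1
  ext i
  simp only [mem_inter]
  tauto

lemma rmat_mul_rmat_proj {n : ℕ} (a b : Ranking n) (i j : Fin n) :
    rmat (proj a (ranked a ∩ ranked b)) i j * rmat (proj b (ranked a ∩ ranked b)) i j =
      rmat a i j * rmat b i j := by
  rw [rmat_proj, rmat_proj]
  split_ifs with h
  · rfl
  · by_cases ha : i ∈ ranked a ∧ j ∈ ranked a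
    · have hb : ¬(i ∈ ranked b ∧ j ∈ ranked b) := by
        simp only [mem_inter] at h
        tauto
      simp [rmat_eq_zero hb]
    · simp [rmat_eq_zero ha]

/-- Axiom 1 (Relevance): the correlation discounts the unevaluated objects. -/
theorem tauHat_relevance (n : ℕ) (a b : Ranking n) (h : 2 ≤ nbar a b) :
    tauHat a b = tauHat (proj a (ranked a ∩ ranked b)) (proj b (ranked a ∩ ranked b)) := by
  simp only [tauHat, nbar_proj, rmat_mul_rmat_proj]
end
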